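/- Let M₅ be the Turing machine with states {A,B,C,D,E,F,H} and symbols {0,1} whose transition table is: δ(A,0)=(1,R,B), δ(A,1)=(0,L,D); δ(B,0)=(1,R,C), δ(B,1)=(0,R,F); δ(C,0)=(1,L,C), δ(C,1)=(1,L,A); δ(D,0)=(0,L,E), δ(D,1)=(1,R,H); δ(E,0)=(1,L,A), δ(E,1)=(0,R,B); δ(F,0)=(0,R,C), δ(F,1)=(0,R,E). Let C(k,n) = ^ω0 1 0^n 1 (C1) 1^{3k} 0^ω. Then: (a) ^ω0 (A0) 0^ω ⊢(47) C(2,5); and for all k, n ≥ 0: (b) C(k,0) ⊢(3) ^ω0 1 (H0) 1^{3k+1} 0^ω; (c) C(k,1) ⊢(3k+37) C(2, 3k+2); (d) C(k,2) ⊢(12k+44) C(k+2, 4); (e) C(k,3) ⊢(3k+57) C(2, 3k+8); (f) C(k,n+4) ⊢(27k²+105k+112) C(3k+5, n). -/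

import Mathlib

open Turing

inductive TSt where | A | B | C | D | E | F | H
deriving DecidableEq

inductive Gam where | s0 | s1
deriving DecidableEq

instance : Inhabited Gam := ⟨Gam.s0⟩

abbrev Cfg := TSt × Tape Gam

/-- The transition table of the machine (values from the halting state `H` are never used). -/
def delta : TSt → Gam → Gam × Dir × TSt
  | .A, .s0 => (.s1, Dir.right, .B)
  | .A, .s1 => (.s0, Dir.left, .D)
  | .B, .s0 => (.s1, Dir.right, .C)
  | .B, .s1 => (.s0, Dir.right, .F)
  | .C, .s0 => (.s1, Dir.left, .C)
  | .C, .s1 => (.s1, Dir.left, .A)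
  | .D, .s0 => (.s0, Dir.left, .E)
  | .D, .s1 => (.s1, Dir.right, .H)
  | .E, .s0 => (.s1, Dir.left, .A)
  | .E, .s1 => (.s0, Dir.right, .B)
  | .F, .s0 => (.s0, Dir.right, .C)
  | .F, .s1 => (.s0, Dir.right, .E)
  | .H, a => (a, Dir.right, .H)

/-- One computation step; `none` if the current state is the halting state `H`. -/
def step (c : Cfg) : Option Cfg :=
  if c.1 = TSt.H then none
  else
    let t := delta c.1 c.2.head
    some (t.2.2, (c.2.write t.1).move t.2.1)

/-- `reaches t c₁ c₂` : iterating `step` exactly `t` times starting from `c₁` yields `c₂`. -/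
def reaches (t : ℕ) (c₁ c₂ : Cfg) : Prop :=
  (fun c => Option.bind c step)^[t] (some c₁) = some c₂

/-- The configuration `^ω0 x (q a) y 0^ω` : state `q`, head reading `a`, the word `x`
written immediately to the left of the head (in order), `y` immediately to the right,
blank elsewhere. -/
def mkCfg (x : List Gam) (q : TSt) (a : Gam) (y : List Gam) : Cfg :=
  (q, ⟨a, ListBlank.mk x.reverse, ListBlank.mk y⟩)

/-- `C(k,n) = ^ω0 1 0^n 1 (C1) 1^{3k} 0^ω`. -/
def Cfg5 (k n : ℕ) : Cfg :=
  mkCfg ([.s1] ++ List.replicate n .s0 ++ [.s1]) .C .s1 (List.replicate (3*k) .s1)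

/-- The word `a^n` prepended to a half-tape. -/
def prependRep (a : Gam) (n : ℕ) (L : ListBlank Gam) : ListBlank Gam :=
  (ListBlank.cons a)^[n] L

/-- The blank half-tape. -/
def blank : ListBlank Gam := ListBlank.mk []

@[simp] theorem head_blank : blank.head = .s0 := rfl

@[simp] theorem tail_blank : blank.tail = blank := rfl

@[simp] theorem cons_blank : ListBlank.cons .s0 blank = blank :=
  ListBlank.cons_head_tail blank

@[simp] theorem prependRep_zero (a : Gam) (L : ListBlank Gam) : prependRep a 0 L = L := rfl

@[simp] theorem prependRep_succ (a : Gam) (n : ℕ) (L : ListBlank Gam) :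
    prependRep a (n + 1) L = ListBlank.cons a (prependRep a n L) :=
  Function.iterate_succ_apply' _ _ _

@[simp] theorem prependRep_cons (a : Gam) (n : ℕ) (L : ListBlank Gam) :
    prependRep a n (ListBlank.cons a L) = ListBlank.cons a (prependRep a n L) :=
  (Function.Commute.refl (ListBlank.cons a)).iterate_left n L

theorem mk_replicate_append (a : Gam) (n : ℕ) (l : List Gam) :
    ListBlank.mk (List.replicate n a ++ l) = prependRep a n (ListBlank.mk l) := by
  induction n with
  | zero => rfl
  | succ n ih => rw [prependRep_succ, ← ih, ListBlank.cons_mk]; rfl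

/-- State `q` with left half-tape `L`; the head reads the first cell of `R`. -/
def conf (q : TSt) (L R : ListBlank Gam) : Cfg := (q, Tape.mk' L R)

theorem reaches_trans {s t : ℕ} {a b c : Cfg} (h₁ : reaches s a b) (h₂ : reaches t b c) :
    reaches (s + t) a c := by
  unfold reaches at *
  rw [add_comm, Function.iterate_add_apply, h₁, h₂]

theorem Cfg5_eq_conf (k n : ℕ) :
    Cfg5 k n = conf .C (ListBlank.cons .s1 (prependRep .s0 n (ListBlank.cons .s1 blank)))
      (ListBlank.cons .s1 (prependRep .s1 (3 * k) blank)) := by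
  have hr : ListBlank.mk (List.replicate (3 * k) Gam.s1) = prependRep .s1 (3 * k) blank := by
    simpa [blank] using mk_replicate_append .s1 (3 * k) []
  have hl : ListBlank.mk ([Gam.s1] ++ List.replicate n Gam.s0 ++ [Gam.s1]).reverse =
      ListBlank.cons .s1 (prependRep .s0 n (ListBlank.cons .s1 blank)) := by
    simp [← mk_replicate_append, blank]
  simp [Cfg5, mkCfg, conf, Tape.mk', hr, ← hl]

/-- States `B`, `F`, `E` erase a block of ones, three cells at a time. -/
theorem reaches_erase (j : ℕ) (L R : ListBlank Gam) :
    reaches (3 * j) (conf .B L (prependRep .s1 (3 * j) R))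
      (conf .B (prependRep .s0 (3 * j) L) R) := by
  induction j generalizing L with
  | zero => simp [reaches]
  | succ j ih =>
    have h : reaches 3 (conf .B L (prependRep .s1 (3 * (j + 1)) R))
        (conf .B (prependRep .s0 3 L) (prependRep .s1 (3 * j) R)) := by
      simp [mul_add, reaches, conf, Tape.mk', step, delta, Tape.write, Tape.move]
    convert reaches_trans h (ih _) using 1
    · ring
    · simp [mul_add]

/-- State `C` moves left through a block of blanks, filling it with ones. -/
theorem reaches_fill (j : ℕ) (L R : ListBlank Gam) :
    reaches j (conf .C (prependRep .s0 j L) (ListBlank.cons .s0 R))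
      (conf .C L (ListBlank.cons .s0 (prependRep .s1 j R))) := by
  induction j generalizing R with
  | zero => simp [reaches]
  | succ j ih =>
    have h : reaches 1 (conf .C (prependRep .s0 (j + 1) L) (ListBlank.cons .s0 R))
        (conf .C (prependRep .s0 j L) (ListBlank.cons .s0 (ListBlank.cons .s1 R))) := by
      simp [reaches, conf, Tape.mk', step, delta, Tape.write, Tape.move]
    have := reaches_trans h (ih _)
    simpa [add_comm] using this

/-- One back-and-forth sweep over the block of ones to the right of the head. -/
theorem reaches_sweep (i : ℕ) (L : ListBlank Gam) :
    reaches (6 * i + 6) (conf .A L (ListBlank.cons .s0 (prependRep .s1 (3 * i + 1) blank)))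
      (conf .C L (prependRep .s1 (3 * i + 4) blank)) := by
  have h₁ : reaches 1 (conf .A L (ListBlank.cons .s0 (prependRep .s1 (3 * i + 1) blank)))
      (conf .B (ListBlank.cons .s1 L)
        (prependRep .s1 (3 * i) (ListBlank.cons .s1 blank))) := by
    simp [reaches, conf, Tape.mk', step, delta, Tape.write, Tape.move]
  have h₂ := reaches_erase i (ListBlank.cons .s1 L) (ListBlank.cons .s1 blank)
  have h₃ : reaches 2 (conf .B (prependRep .s0 (3 * i) (ListBlank.cons .s1 L))
        (ListBlank.cons .s1 blank))
      (conf .C (prependRep .s0 (3 * i + 2) (ListBlank.cons .s1 L))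
        (ListBlank.cons .s0 blank)) := by
    simp [reaches, conf, Tape.mk', step, delta, Tape.write, Tape.move]
  have h₄ := reaches_fill (3 * i + 2) (ListBlank.cons .s1 L) blank
  have h₅ : reaches 1 (conf .C (ListBlank.cons .s1 L)
        (ListBlank.cons .s0 (prependRep .s1 (3 * i + 2) blank)))
      (conf .C L (prependRep .s1 (3 * i + 4) blank)) := by
    simp [reaches, conf, Tape.mk', step, delta, Tape.write, Tape.move]
  convert reaches_trans h₁ (reaches_trans h₂ (reaches_trans h₃ (reaches_trans h₄ h₅))) using 1
  ring

theorem reaches_sweep_cons (i : ℕ) (L : ListBlank Gam) :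
    reaches (6 * i + 7)
      (conf .A (ListBlank.cons .s0 L) (ListBlank.cons .s0 (prependRep .s1 (3 * i + 1) blank)))
      (conf .A L (ListBlank.cons .s0 (prependRep .s1 (3 * (i + 1) + 1) blank))) := by
  refine reaches_trans (reaches_sweep i _) (t := 1) ?_
  simp [mul_add, reaches, conf, Tape.mk', step, delta, Tape.write, Tape.move]

/-- Iterated sweeps consume a block of blanks to the left of the head. -/
theorem reaches_sweep_iterate (m i : ℕ) (L : ListBlank Gam) :
    reaches (m * (6 * i + 3 * m + 4))
      (conf .A (prependRep .s0 m L)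
        (ListBlank.cons .s0 (prependRep .s1 (3 * i + 1) blank)))
      (conf .A L (ListBlank.cons .s0 (prependRep .s1 (3 * (i + m) + 1) blank))) := by
  induction m generalizing i with
  | zero => simp [reaches]
  | succ m ih =>
    rw [prependRep_succ]
    convert reaches_trans (reaches_sweep_cons i _) (ih (i + 1)) using 1
    · ring
    · rw [add_assoc i 1 m, add_comm 1 m]

/-- Rebuilding seven ones from the blank end of an erased block. -/
theorem reaches_rebuild (L : ListBlank Gam) :
    reaches 26 (conf .B (ListBlank.cons .s0 L) blank)
      (conf .C (ListBlank.cons .s1 L) (prependRep .s1 7 blank)) := by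
  simp [reaches, conf, Tape.mk', step, delta, Tape.write, Tape.move]

theorem reaches_erase_rebuild (j : ℕ) :
    reaches (3 * j + 30) (conf .A blank (ListBlank.cons .s0 (prependRep .s1 (3 * (j + 1)) blank)))
      (Cfg5 2 (3 * j + 2)) := by
  have h₁ : reaches 1
      (conf .A blank (ListBlank.cons .s0 (prependRep .s1 (3 * (j + 1)) blank)))
      (conf .B (ListBlank.cons .s1 blank) (prependRep .s1 (3 * (j + 1)) blank)) := by
    simp [mul_add, reaches, conf, Tape.mk', step, delta, Tape.write, Tape.move]
  have h₂ := reaches_erase (j + 1) (ListBlank.cons .s1 blank) blank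
  have h₃ := reaches_rebuild (prependRep .s0 (3 * j + 2) (ListBlank.cons .s1 blank))
  rw [← prependRep_succ] at h₃
  rw [Cfg5_eq_conf]
  convert reaches_trans h₁ (reaches_trans h₂ h₃) using 1
  · ring
  · simp

theorem reaches_Cfg5_zero (k : ℕ) :
    reaches 3 (Cfg5 k 0) (mkCfg [.s1] .H .s0 (List.replicate (3 * k + 1) .s1)) := by
  have hr : ListBlank.mk (List.replicate (3 * k + 1) Gam.s1) =
      prependRep .s1 (3 * k + 1) blank := by
    simpa [blank] using mk_replicate_append .s1 (3 * k + 1) []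
  have hl : ListBlank.mk [Gam.s1] = ListBlank.cons .s1 blank := rfl
  rw [Cfg5_eq_conf, mkCfg, hr, List.reverse_singleton, hl]
  simp [reaches, conf, Tape.mk', step, delta, Tape.write, Tape.move]

theorem reaches_Cfg5_one (k : ℕ) : reaches (3 * k + 37) (Cfg5 k 1) (Cfg5 2 (3 * k + 2)) := by
  have h : reaches 7 (Cfg5 k 1)
      (conf .A blank (ListBlank.cons .s0 (prependRep .s1 (3 * (k + 1)) blank))) := by
    rw [Cfg5_eq_conf]
    simp [mul_add, reaches, conf, Tape.mk', step, delta, Tape.write, Tape.move]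
  convert reaches_trans h (reaches_erase_rebuild k) using 1
  ring

theorem reaches_Cfg5_two (k : ℕ) : reaches (12 * k + 44) (Cfg5 k 2) (Cfg5 (k + 2) 4) := by
  have h : reaches 25 (Cfg5 k 2)
      (conf .A (ListBlank.cons .s0 (ListBlank.cons .s1
          (prependRep .s0 4 (ListBlank.cons .s1 blank))))
        (ListBlank.cons .s0 (prependRep .s1 (3 * k + 1) blank))) := by
    rw [Cfg5_eq_conf]
    simp [reaches, conf, Tape.mk', step, delta, Tape.write, Tape.move]
  rw [Cfg5_eq_conf (k + 2), ← prependRep_succ]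
  convert reaches_trans h (reaches_trans (reaches_sweep_cons k _) (reaches_sweep (k + 1) _)) using 1
  · ring
  · rw [show 3 * (k + 2) + 1 = 3 * (k + 1) + 4 by ring]

theorem reaches_Cfg5_three (k : ℕ) : reaches (3 * k + 57) (Cfg5 k 3) (Cfg5 2 (3 * k + 8)) := by
  have h : reaches 21 (Cfg5 k 3)
      (conf .A blank (ListBlank.cons .s0 (prependRep .s1 (3 * (k + 2 + 1)) blank))) := by
    rw [Cfg5_eq_conf]
    simp [mul_add, reaches, conf, Tape.mk', step, delta, Tape.write, Tape.move]
  convert reaches_trans h (reaches_erase_rebuild (k + 2)) using 1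
  · ring
  · rw [show 3 * (k + 2) + 2 = 3 * k + 8 by ring]

theorem reaches_Cfg5_add_four (k n : ℕ) :
    reaches (27 * k ^ 2 + 105 * k + 112) (Cfg5 k (n + 4)) (Cfg5 (3 * k + 5) n) := by
  set L := prependRep .s0 n (ListBlank.cons .s1 blank) with hL
  have h₁ : reaches 12 (Cfg5 k (n + 4))
      (conf .B (ListBlank.cons .s1 L) (prependRep .s1 (3 * (k + 1)) (prependRep .s1 2 blank))) := by
    rw [Cfg5_eq_conf]
    simp [mul_add, reaches, conf, Tape.mk', step, delta, Tape.write, Tape.move, hL]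
  have h₂ := reaches_erase (k + 1) (ListBlank.cons .s1 L) (prependRep .s1 2 blank)
  have h₃ : reaches 10
      (conf .B (prependRep .s0 (3 * (k + 1)) (ListBlank.cons .s1 L)) (prependRep .s1 2 blank))
      (conf .A (prependRep .s0 (3 * (k + 1)) (ListBlank.cons .s1 L))
        (ListBlank.cons .s0 (prependRep .s1 (3 * 1 + 1) blank))) := by
    simp [mul_add, reaches, conf, Tape.mk', step, delta, Tape.write, Tape.move]
  have h₄ := reaches_sweep_iterate (3 * (k + 1)) 1 (ListBlank.cons .s1 L)
  have h₅ := reaches_sweep (1 + 3 * (k + 1)) (ListBlank.cons .s1 L)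
  rw [Cfg5_eq_conf (3 * k + 5), ← prependRep_succ]
  convert reaches_trans h₁ (reaches_trans h₂ (reaches_trans h₃ (reaches_trans h₄ h₅))) using 1
  · ring
  · congr 2
    ring

theorem reaches_Cfg5_of_blank : reaches 47 (mkCfg [] .A .s0 []) (Cfg5 2 5) := by
  have h : mkCfg [] .A .s0 [] = conf .A blank blank := rfl
  rw [Cfg5_eq_conf, h]
  simp [reaches, conf, Tape.mk', step, delta, Tape.write, Tape.move]

theorem stmt11 :
    reaches 47 (mkCfg [] .A .s0 []) (Cfg5 2 5) ∧
    ∀ k n : ℕ,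
      reaches 3 (Cfg5 k 0) (mkCfg [.s1] .H .s0 (List.replicate (3*k+1) .s1)) ∧
      reaches (3*k + 37) (Cfg5 k 1) (Cfg5 2 (3*k+2)) ∧
      reaches (12*k + 44) (Cfg5 k 2) (Cfg5 (k+2) 4) ∧
      reaches (3*k + 57) (Cfg5 k 3) (Cfg5 2 (3*k+8)) ∧
      reaches (27*k^2 + 105*k + 112) (Cfg5 k (n+4)) (Cfg5 (3*k+5) n) := by
  exact ⟨reaches_Cfg5_of_blank, fun k n => ⟨reaches_Cfg5_zero k, reaches_Cfg5_one k,
    reaches_Cfg5_two k, reaches_Cfg5_three k, reaches_Cfg5_add_four k n⟩⟩
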